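/- Let H be a separable Banach space, S a nonempty finite set, and X = H × S. Let (P_{s,t})_{s ≤ t} be a two-parameter family of Markov kernels on X satisfying the Chapman–Kolmogorov relation. Assume: (i) for every x ∈ X and η > 0 there exists R > 0 such that P_{s,t}(x)({(u,j) ∈ X : ‖u‖ ≤ R}) > 1 − η for all s ≤ t; (ii) for every t ∈ ℝ, every bounded set B ⊆ H and every η > 0 there exists T > 0 such that d_L^*(P_{s,t}(x₁), P_{s,t}(x₂)) ≤ η for all s ≤ t − T and all x₁, x₂ ∈ B × S. Then for every t ∈ ℝ there exists a Borel probability measure μ_t on X, independent of x, such that for every x ∈ X, d_L^*(P_{s,t}(x), μ_t) → 0 as s → −∞. -/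

import Mathlib

open MeasureTheory ProbabilityTheory Filter Topology

/-- The metric on X = H × S: d_X((u,i),(v,j)) = ‖u − v‖ + (0 if i = j, 1 otherwise). -/
noncomputable def distX {H S : Type*} [NormedAddCommGroup H] [DecidableEq S]
    (x y : H × S) : ℝ :=
  ‖x.1 - y.1‖ + (if x.2 = y.2 then (0 : ℝ) else 1)

/-- The bounded-Lipschitz distance d_L^* between two Borel measures on H × S:
the supremum of |∫φ dμ − ∫φ dν| over functions φ admitting a bound C for |φ| and a
Lipschitz constant K (w.r.t. distX) with C + K ≤ 1. -/
noncomputable def dLstar {H S : Type*} [NormedAddCommGroup H] [DecidableEq S]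
    [MeasurableSpace H] [MeasurableSpace S]
    (μ ν : Measure (H × S)) : ℝ :=
  sSup { r : ℝ | ∃ φ : H × S → ℝ,
    (∃ C K : ℝ, 0 ≤ C ∧ 0 ≤ K ∧ C + K ≤ 1 ∧ (∀ x, |φ x| ≤ C) ∧
      ∀ x y, |φ x - φ y| ≤ K * distX x y) ∧
    r = |(∫ x, φ x ∂μ) - ∫ x, φ x ∂ν| }

/-- Test functions bounded by `C` and `K`-Lipschitz for `distX`, with `C + K ≤ 1`. -/
def IsBLTest {H S : Type*} [NormedAddCommGroup H] [DecidableEq S] (φ : H × S → ℝ) : Prop :=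
  ∃ C K : ℝ, 0 ≤ C ∧ 0 ≤ K ∧ C + K ≤ 1 ∧ (∀ x, |φ x| ≤ C) ∧
    ∀ x y, |φ x - φ y| ≤ K * distX x y

/-- The discrete metric, for which distinct points are at distance `1`. -/
abbrev discreteMetricSpace (S : Type*) [DecidableEq S] : MetricSpace S where
  dist i j := if i = j then 0 else 1
  dist_self i := by simp
  dist_comm i j := by simp [eq_comm]
  dist_triangle i j k := by
    by_cases hij : i = j
    · subst hij; simp
    · by_cases hjk : j = k
      · subst hjk; simp
      · split_ifs <;> norm_num
  eq_of_dist_eq_zero {i j} h := by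
    by_contra hij
    simp [hij] at h

lemma abs_min_infDist_div_two_sub_le {X : Type*} [MetricSpace X] (K : Set X) (δ : ℝ) (x y : X) :
    |min δ (Metric.infDist x K) / 2 - min δ (Metric.infDist y K) / 2| ≤ 1 / 2 * dist x y := by
  have h := ((Metric.lipschitz_infDist_pt K).const_min δ).dist_le_mul x y
  rw [Real.dist_eq] at h
  rw [← sub_div, abs_div, abs_two]
  simp only [NNReal.coe_one] at h
  linarith

section Tightness

variable {X : Type*} [MetricSpace X] [MeasurableSpace X]

/-- If the integrals of `x ↦ min δ (infDist x K) / 2` against two probability measures are close,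
then the mass far away from `K` for one is controlled by the mass outside `K` for the other. -/
lemma measureReal_le_infDist_le [BorelSpace X] (μ ν : Measure X) [IsProbabilityMeasure μ]
    [IsProbabilityMeasure ν] {K : Set X} (hK : MeasurableSet K) {δ η : ℝ} (hδ : 0 < δ)
    (h : |(∫ x, min δ (Metric.infDist x K) / 2 ∂μ) - ∫ x, min δ (Metric.infDist x K) / 2 ∂ν|
      ≤ δ * η / 2) :
    μ.real {x | δ ≤ Metric.infDist x K} ≤ ν.real Kᶜ + η := by
  have hcont : Continuous fun x => min δ (Metric.infDist x K) / 2 := by fun_prop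
  have h0 x : 0 ≤ min δ (Metric.infDist x K) / 2 :=
    div_nonneg (le_min hδ.le Metric.infDist_nonneg) (by norm_num)
  have hle x : min δ (Metric.infDist x K) / 2 ≤ δ / 2 :=
    div_le_div_of_nonneg_right (min_le_left _ _) (by norm_num)
  have hint (ρ : Measure X) [IsProbabilityMeasure ρ] :
      Integrable (fun x => min δ (Metric.infDist x K) / 2) ρ :=
    .of_bound hcont.aestronglyMeasurable (δ / 2)
      (.of_forall fun x => by rw [Real.norm_of_nonneg (h0 x)]; exact hle x)
  have hlow : δ / 2 * μ.real {x | δ ≤ Metric.infDist x K}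
      ≤ ∫ x, min δ (Metric.infDist x K) / 2 ∂μ := by
    refine le_trans ?_ (mul_meas_ge_le_integral_of_nonneg (.of_forall h0) (hint μ) (δ / 2))
    refine mul_le_mul_of_nonneg_left (measureReal_mono fun x hx => ?_) (by positivity)
    rw [Set.mem_ofPred_eq] at hx ⊢
    rw [min_eq_left hx]
  have hup : ∫ x, min δ (Metric.infDist x K) / 2 ∂ν ≤ δ / 2 * ν.real Kᶜ := by
    have : ∫ x, Kᶜ.indicator (fun _ => δ / 2) x ∂ν = δ / 2 * ν.real Kᶜ := by
      rw [integral_indicator_const _ hK.compl, smul_eq_mul, mul_comm]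
    rw [← this]
    refine integral_mono (hint ν) ((integrable_const _).indicator hK.compl) fun x => ?_
    by_cases hx : x ∈ K
    · simp [hx, Metric.infDist_zero_of_mem hx, hδ.le]
    · simpa [hx] using hle x
  have := (abs_le.1 h).2
  have h2 : δ / 2 * μ.real {x | δ ≤ Metric.infDist x K} ≤ δ / 2 * (ν.real Kᶜ + η) := by
    linarith
  exact le_of_mul_le_mul_left h2 (by positivity)

/-- In a complete metric space, a set of measures which gives small mass to the points far from
suitable compact sets is tight. -/
lemma isTightMeasureSet_of_infDist [CompleteSpace X] {M : Set (Measure X)}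
    (h : ∀ δ : ℝ, 0 < δ → ∀ η : ENNReal, 0 < η → ∃ K : Set X, IsCompact K ∧ K.Nonempty ∧
      ∀ μ ∈ M, μ {x | δ ≤ Metric.infDist x K} ≤ η) :
    IsTightMeasureSet M := by
  rw [isTightMeasureSet_iff_exists_isCompact_measure_compl_le]
  intro ε hε
  obtain ⟨η, hη, hsum⟩ := ENNReal.exists_pos_sum_of_countable hε.ne' ℕ
  choose K hKc hKn hK using fun n : ℕ =>
    h (1 / ((n : ℝ) + 1)) (by positivity) (η n) (by simpa using hη n)
  refine ⟨⋂ n : ℕ, {x | Metric.infDist x (K n) ≤ 1 / ((n : ℝ) + 1)}, ?_, fun μ hμ => ?_⟩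
  · refine isCompact_iff_totallyBounded_isComplete.2 ⟨?_, ?_⟩
    · rw [Metric.totallyBounded_iff]
      intro r hr
      obtain ⟨n, hn⟩ := exists_nat_one_div_lt (half_pos hr)
      obtain ⟨F, hF, hcov⟩ := Metric.totallyBounded_iff.1 (hKc n).totallyBounded _ (half_pos hr)
      refine ⟨F, hF, fun x hx => ?_⟩
      have hx' : Metric.infDist x (K n) < r / 2 := (Set.mem_iInter.1 hx n).trans_lt hn
      obtain ⟨y, hy, hxy⟩ := (Metric.infDist_lt_iff (hKn n)).1 hx'
      obtain ⟨z, hz, hyz⟩ := Set.mem_iUnion₂.1 (hcov hy)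
      refine Set.mem_iUnion₂.2 ⟨z, hz, ?_⟩
      rw [Metric.mem_ball] at hyz ⊢
      linarith [dist_triangle x y z]
    · exact (isClosed_iInter fun n =>
        isClosed_le (Metric.continuous_infDist_pt _) continuous_const).isComplete
  · rw [Set.compl_iInter]
    refine (measure_iUnion_le _).trans ((ENNReal.tsum_le_tsum fun n => ?_).trans hsum.le)
    refine (measure_mono fun x hx => ?_).trans (hK n μ hμ)
    rw [Set.mem_compl_iff, Set.mem_ofPred_eq, not_le] at hx
    exact hx.le

/-- A sequence of probability measures that is Cauchy uniformly over bounded Lipschitz test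
functions has a weakly convergent subsequence. -/
lemma exists_tendsto_subseq_of_cauchy [BorelSpace X] [CompleteSpace X] [SecondCountableTopology X]
    (μ : ℕ → ProbabilityMeasure X)
    (h : ∀ ε : ℝ, 0 < ε → ∃ N : ℕ, ∀ n ≥ N, ∀ φ : X → ℝ, (∀ x, |φ x| ≤ 1 / 2) →
      (∀ x y, |φ x - φ y| ≤ 1 / 2 * dist x y) →
      |(∫ x, φ x ∂(μ n : Measure X)) - ∫ x, φ x ∂(μ N : Measure X)| ≤ ε) :
    ∃ (ν : ProbabilityMeasure X) (k : ℕ → ℕ), StrictMono k ∧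
      Tendsto (μ ∘ k) atTop (𝓝 ν) := by
  have : Nonempty X := (μ 0).nonempty
  obtain ⟨x₀⟩ := this
  have htight : IsTightMeasureSet {((ρ : ProbabilityMeasure X) : Measure X) | ρ ∈ Set.range μ} := by
    refine isTightMeasureSet_of_infDist fun δ hδ η hη => ?_
    wlog hδ1 : δ ≤ 1 generalizing δ
    · obtain ⟨K, hKc, hKn, hK⟩ := this 1 one_pos le_rfl
      exact ⟨K, hKc, hKn, fun ρ hρ => (measure_mono fun x hx =>
        (not_le.1 hδ1).le.trans hx).trans (hK ρ hρ)⟩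
    obtain ⟨r, hr, hrη⟩ := ENNReal.lt_iff_exists_nnreal_btwn.1 hη
    have hr0 : 0 < (r : ℝ) := by simpa using hr
    obtain ⟨N, hN⟩ := h (δ * (r / 2) / 2) (by positivity)
    have hcomp n : ∃ K : Set X, IsCompact K ∧ (μ n : Measure X) Kᶜ ≤ (r / 2 : NNReal) := by
      obtain ⟨K, hKc, hK⟩ := isTightMeasureSet_iff_exists_isCompact_measure_compl_le.1
        (isTightMeasureSet_singleton (μ := (μ n : Measure X))) (r / 2 : NNReal)
        (by have : 0 < r / 2 := half_pos (by exact_mod_cast hr0)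
            exact_mod_cast this)
      exact ⟨K, hKc, hK _ rfl⟩
    choose K hKc hK using hcomp
    set L : Set X := insert x₀ (⋃ n ∈ Set.Iic N, K n)
    have hLc : IsCompact L := ((Set.finite_Iic N).isCompact_biUnion fun n _ => hKc n).insert x₀
    have hLμ n (hn : n ≤ N) : (μ n : Measure X).real Lᶜ ≤ r / 2 := by
      refine ENNReal.toReal_le_of_le_ofReal (by positivity)
        ((measure_mono (Set.compl_subset_compl.2 ?_)).trans ((hK n).trans ?_))
      · exact (Set.subset_biUnion_of_mem (u := K) (Set.mem_Iic.2 hn)).trans (Set.subset_insert _ _)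
      · rw [← ENNReal.ofReal_coe_nnreal]; simp
    refine ⟨L, hLc, Set.insert_nonempty _ _, ?_⟩
    rintro _ ⟨_, ⟨n, rfl⟩, rfl⟩
    have key : (μ n : Measure X).real {x | δ ≤ Metric.infDist x L} ≤ r := by
      rcases le_total n N with hn | hn
      · refine (measureReal_mono (fun x hx hxL => ?_)).trans ((hLμ n hn).trans (by linarith))
        rw [Set.mem_ofPred_eq, Metric.infDist_zero_of_mem hxL] at hx
        exact hδ.not_ge hx
      · have := measureReal_le_infDist_le (μ n : Measure X) (μ N : Measure X) hLc.measurableSet hδ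
          (hN n hn (fun x => min δ (Metric.infDist x L) / 2) (fun x => ?_)
            (abs_min_infDist_div_two_sub_le L δ))
        · linarith [hLμ N le_rfl]
        · rw [abs_of_nonneg (div_nonneg (le_min hδ.le Metric.infDist_nonneg) (by norm_num))]
          linarith [min_le_left δ (Metric.infDist x L)]
    refine le_trans ?_ hrη.le
    rw [← ENNReal.ofReal_coe_nnreal]
    exact (ENNReal.le_ofReal_iff_toReal_le (measure_ne_top _ _) hr0.le).2 key
  obtain ⟨ν, -, k, hk, hlim⟩ := (isCompact_closure_of_isTightMeasureSet htight).tendsto_subseq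
    (x := μ) fun n => subset_closure (Set.mem_range_self n)
  exact ⟨ν, k, hk, hlim⟩

end Tightness

section BoundedLipschitz

variable {H S : Type*} [NormedAddCommGroup H] [DecidableEq S]

lemma IsBLTest.abs_le_one {φ : H × S → ℝ} (hφ : IsBLTest φ) (x : H × S) : |φ x| ≤ 1 := by
  obtain ⟨C, K, -, hK, hCK, hC, -⟩ := hφ
  linarith [hC x]

lemma IsBLTest.continuous_left {φ : H × S → ℝ} (hφ : IsBLTest φ) (i : S) :
    Continuous fun u => φ (u, i) := by
  obtain ⟨C, K, -, hK, -, -, hL⟩ := hφ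
  refine (LipschitzWith.of_dist_le_mul (K := .mk K hK) fun u v => ?_).continuous
  rw [Real.dist_eq, dist_eq_norm, NNReal.coe_mk]
  simpa [distX] using hL (u, i) (v, i)

variable [MeasurableSpace H] [MeasurableSpace S]

lemma dLstar_nonneg (μ ν : Measure (H × S)) : 0 ≤ dLstar μ ν := by
  refine Real.sSup_nonneg ?_
  rintro _ ⟨φ, -, rfl⟩
  exact abs_nonneg _

lemma dLstar_le {μ ν : Measure (H × S)} {ε : ℝ} (hε : 0 ≤ ε)
    (h : ∀ φ : H × S → ℝ, IsBLTest φ → |(∫ x, φ x ∂μ) - ∫ x, φ x ∂ν| ≤ ε) :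
    dLstar μ ν ≤ ε := by
  refine Real.sSup_le ?_ hε
  rintro _ ⟨φ, hφ, rfl⟩
  exact h φ hφ

lemma IsBLTest.abs_integral_le_one {φ : H × S → ℝ} (hφ : IsBLTest φ) (μ : Measure (H × S))
    [IsProbabilityMeasure μ] : |∫ x, φ x ∂μ| ≤ 1 := by
  simpa using norm_integral_le_of_norm_le_const (μ := μ) (f := φ) (.of_forall hφ.abs_le_one)

lemma IsBLTest.abs_integral_sub_le_dLstar {φ : H × S → ℝ} (hφ : IsBLTest φ)
    (μ ν : Measure (H × S)) [IsProbabilityMeasure μ] [IsProbabilityMeasure ν] :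
    |(∫ x, φ x ∂μ) - ∫ x, φ x ∂ν| ≤ dLstar μ ν := by
  refine le_csSup ⟨2, ?_⟩ ⟨φ, hφ, rfl⟩
  rintro _ ⟨ψ, hψ : IsBLTest ψ, rfl⟩
  linarith [abs_sub (∫ x, ψ x ∂μ) (∫ x, ψ x ∂ν), hψ.abs_integral_le_one μ,
    hψ.abs_integral_le_one ν]

variable [BorelSpace H] [Countable S] [MeasurableSingletonClass S]

lemma IsBLTest.measurable {φ : H × S → ℝ} (hφ : IsBLTest φ) : Measurable φ :=
  measurable_from_prod_countable_left fun i => (hφ.continuous_left i).measurable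

lemma IsBLTest.integrable {φ : H × S → ℝ} (hφ : IsBLTest φ) (μ : Measure (H × S))
    [IsProbabilityMeasure μ] : Integrable φ μ :=
  .of_bound hφ.measurable.aestronglyMeasurable 1 (.of_forall hφ.abs_le_one)

/-- A `dLstar`-Cauchy sequence of probability measures has a subsequence along which the integrals
of all test functions converge to those against some probability measure. -/
lemma exists_subseq_tendsto_of_dLstar_cauchy [CompleteSpace H] [SecondCountableTopology H]
    [Finite S] (ν : ℕ → Measure (H × S)) [∀ n, IsProbabilityMeasure (ν n)]
    (h : ∀ ε : ℝ, 0 < ε → ∃ N : ℕ, ∀ n ≥ N, dLstar (ν n) (ν N) ≤ ε) :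
    ∃ (μ : Measure (H × S)) (k : ℕ → ℕ), IsProbabilityMeasure μ ∧ StrictMono k ∧
      ∀ φ : H × S → ℝ, IsBLTest φ →
        Tendsto (fun n => ∫ x, φ x ∂(ν (k n))) atTop (𝓝 (∫ x, φ x ∂μ)) := by
  let : MetricSpace S := discreteMetricSpace S
  have : BorelSpace S := by
    refine ⟨?_⟩
    rw [borel_eq_top_of_discrete]
    exact top_unique fun s _ => s.toFinite.measurableSet
  have hdist (x y : H × S) : dist x y ≤ distX x y := by
    refine max_le ?_ ?_
    · rw [dist_eq_norm]
      unfold distX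
      split_ifs <;> simp
    · exact le_add_of_nonneg_left (norm_nonneg _)
  obtain ⟨μ, k, hk, hlim⟩ := exists_tendsto_subseq_of_cauchy
    (fun n => (⟨ν n, inferInstance⟩ : ProbabilityMeasure (H × S))) fun ε hε => by
      obtain ⟨N, hN⟩ := h ε hε
      refine ⟨N, fun n hn φ hb hL => ?_⟩
      have hφ : IsBLTest φ := ⟨1 / 2, 1 / 2, by norm_num, by norm_num, by norm_num, hb,
        fun x y => (hL x y).trans (by gcongr; exact hdist x y)⟩
      exact (hφ.abs_integral_sub_le_dLstar (ν n) (ν N)).trans (hN n hn)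
  refine ⟨μ, k, inferInstance, hk, fun φ hφ => ?_⟩
  have hc : Continuous φ := continuous_prod_of_discrete_right.2 hφ.continuous_left
  exact ProbabilityMeasure.tendsto_iff_forall_integral_tendsto.1 hlim
    (BoundedContinuousFunction.ofNormedAddCommGroup φ hc 1 hφ.abs_le_one)

/-- Contraction on bounded sets and boundedness in probability make `s ↦ P s t x` a Cauchy family
for `dLstar` as `s → -∞`. -/
lemma exists_forall_le_dLstar_le (P : ℝ → ℝ → Kernel (H × S) (H × S))
    (hMarkov : ∀ s t : ℝ, s ≤ t → IsMarkovKernel (P s t))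
    (hCK : ∀ s r t : ℝ, s ≤ r → r ≤ t → ∀ x : H × S, ∀ A : Set (H × S),
      MeasurableSet A → P s t x A = ∫⁻ y, P r t y A ∂(P s r x))
    (hBound : ∀ x : H × S, ∀ η : ℝ, 0 < η → ∃ R : ℝ, 0 < R ∧
      ∀ s t : ℝ, s ≤ t →
        P s t x {y : H × S | ‖y.1‖ ≤ R} > 1 - ENNReal.ofReal η)
    (hContr : ∀ t : ℝ, ∀ B : Set H, Bornology.IsBounded B → ∀ η : ℝ, 0 < η →
      ∃ T : ℝ, 0 < T ∧ ∀ s : ℝ, s ≤ t - T → ∀ x₁ x₂ : H × S,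
        x₁.1 ∈ B → x₂.1 ∈ B → dLstar (P s t x₁) (P s t x₂) ≤ η)
    (t : ℝ) (x : H × S) {ε : ℝ} (hε : 0 < ε) :
    ∃ s₀ ≤ t, ∀ s ≤ s₀, ∀ s' ≤ s, dLstar (P s' t x) (P s t x) ≤ ε := by
  obtain ⟨R, -, hR⟩ := hBound x (ε / 4) (by positivity)
  obtain ⟨T, hT, hd⟩ := hContr t (Metric.closedBall 0 (max R ‖x.1‖))
    Metric.isBounded_closedBall (ε / 2) (by positivity)
  refine ⟨t - T, by linarith, fun s hs s' hs' => dLstar_le hε.le fun φ hφ => ?_⟩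
  have hst : s ≤ t := by linarith
  have := hMarkov s t hst
  have := hMarkov s' s hs'
  have := hMarkov s' t (hs'.trans hst)
  have hcomp : P s' t = P s t ∘ₖ P s' s := by
    ext y A hA
    rw [hCK s' s t hs' hst y A hA, Kernel.comp_apply' _ _ _ hA]
  set A : Set (H × S) := {y | ‖y.1‖ ≤ R}
  have hAm : MeasurableSet A := measurableSet_le (by fun_prop) measurable_const
  have hAc : (P s' s x).real Aᶜ ≤ ε / 4 := by
    refine ENNReal.toReal_le_of_le_ofReal (by positivity) ?_
    rw [prob_compl_eq_one_sub hAm]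
    exact tsub_le_iff_left.2 (tsub_le_iff_right.1 (hR s' s hs').le)
  set g : H × S → ℝ := fun y => ∫ z, φ z ∂(P s t y) with hg
  have hgm : StronglyMeasurable g := hφ.measurable.stronglyMeasurable.integral_kernel
  have hg1 (y : H × S) : |g y| ≤ 1 := hφ.abs_integral_le_one _
  have hgi : Integrable g (P s' s x) := .of_bound hgm.aestronglyMeasurable 1 (.of_forall hg1)
  have hptw (y : H × S) : ‖g y - g x‖ ≤ ε / 2 + Aᶜ.indicator (fun _ => (2 : ℝ)) y := by
    rw [Real.norm_eq_abs]
    by_cases hy : y ∈ A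
    · have h1 : y.1 ∈ Metric.closedBall (0 : H) (max R ‖x.1‖) := by
        rw [mem_closedBall_zero_iff]
        exact le_max_of_le_left hy
      have h2 : x.1 ∈ Metric.closedBall (0 : H) (max R ‖x.1‖) := by simp
      simpa [hy] using (hφ.abs_integral_sub_le_dLstar _ _).trans (hd s hs y x h1 h2)
    · rw [Set.indicator_of_mem (Set.mem_compl hy)]
      linarith [abs_sub (g y) (g x), hg1 y, hg1 x]
  have hind : Integrable (Aᶜ.indicator fun _ => (2 : ℝ)) (P s' s x) :=
    (integrable_const _).indicator hAm.compl
  calc |(∫ z, φ z ∂(P s' t x)) - ∫ z, φ z ∂(P s t x)|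
      = ‖∫ y, (g y - g x) ∂(P s' s x)‖ := by
        rw [integral_sub hgi (integrable_const _), hcomp,
          Kernel.integral_comp (hcomp ▸ hφ.integrable (P s' t x))]
        simp [hg, Real.norm_eq_abs]
    _ ≤ ∫ y, (ε / 2 + Aᶜ.indicator (fun _ => (2 : ℝ)) y) ∂(P s' s x) :=
        norm_integral_le_of_norm_le ((integrable_const _).add hind) (.of_forall hptw)
    _ = ε / 2 + (P s' s x).real Aᶜ * 2 := by
        rw [integral_add (integrable_const _) hind, integral_indicator_const _ hAm.compl]
        simp
    _ ≤ ε := by linarith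

end BoundedLipschitz

/-- existence of a pullback limit measure μ_t, independent of x,
with d_L^*(P_{s,t}(x), μ_t) → 0 as s → −∞. -/
theorem stmt_0
    {H S : Type*}
    [NormedAddCommGroup H] [NormedSpace ℝ H] [CompleteSpace H]
    [SecondCountableTopology H] [MeasurableSpace H] [BorelSpace H]
    [Fintype S] [Nonempty S] [DecidableEq S]
    [MeasurableSpace S] [MeasurableSingletonClass S]
    (P : ℝ → ℝ → Kernel (H × S) (H × S))
    (hMarkov : ∀ s t : ℝ, s ≤ t → IsMarkovKernel (P s t))
    (hCK : ∀ s r t : ℝ, s ≤ r → r ≤ t → ∀ x : H × S, ∀ A : Set (H × S),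
      MeasurableSet A → P s t x A = ∫⁻ y, P r t y A ∂(P s r x))
    (hBound : ∀ x : H × S, ∀ η : ℝ, 0 < η → ∃ R : ℝ, 0 < R ∧
      ∀ s t : ℝ, s ≤ t →
        P s t x {y : H × S | ‖y.1‖ ≤ R} > 1 - ENNReal.ofReal η)
    (hContr : ∀ t : ℝ, ∀ B : Set H, Bornology.IsBounded B → ∀ η : ℝ, 0 < η →
      ∃ T : ℝ, 0 < T ∧ ∀ s : ℝ, s ≤ t - T → ∀ x₁ x₂ : H × S,
        x₁.1 ∈ B → x₂.1 ∈ B → dLstar (P s t x₁) (P s t x₂) ≤ η) :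
    ∀ t : ℝ, ∃ μ : Measure (H × S), IsProbabilityMeasure μ ∧
      ∀ x : H × S, Tendsto (fun s : ℝ => dLstar (P s t x) μ) atBot (nhds 0) := by

  intro t
  have hprob (s : ℝ) (hs : s ≤ t) (x : H × S) : IsProbabilityMeasure (P s t x) :=
    (hMarkov s t hs).isProbabilityMeasure x
  set x₀ : H × S := (0, Classical.arbitrary S)
  have hCauchy {ε : ℝ} (hε : 0 < ε) :=
    exists_forall_le_dLstar_le P hMarkov hCK hBound hContr t x₀ hε
  have (n : ℕ) : IsProbabilityMeasure (P (t - n) t x₀) := hprob _ (by simp) x₀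
  obtain ⟨μ, k, hμ, hk, hlim⟩ := exists_subseq_tendsto_of_dLstar_cauchy
    (fun n : ℕ => P (t - n) t x₀) fun ε hε => by
      obtain ⟨s₀, -, hs₀⟩ := hCauchy hε
      obtain ⟨N, hN⟩ := exists_nat_ge (t - s₀)
      refine ⟨N, fun n hn => hs₀ _ (by linarith) _ ?_⟩
      have : (N : ℝ) ≤ n := by exact_mod_cast hn
      linarith
  refine ⟨μ, hμ, fun x => ?_⟩
  rw [Metric.tendsto_nhds]
  intro ε hε
  obtain ⟨s₀, hs₀t, hs₀⟩ := hCauchy (show 0 < ε / 3 by positivity)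
  obtain ⟨T, -, hT⟩ := hContr t {x.1, x₀.1} (Set.toFinite _).isBounded (ε / 3) (by positivity)
  filter_upwards [eventually_le_atBot s₀, eventually_le_atBot (t - T)] with s hs hsT
  have := hprob s (hs.trans hs₀t)
  rw [Real.dist_eq, sub_zero, abs_of_nonneg (dLstar_nonneg _ _)]
  refine (dLstar_le (ε := ε / 3 + ε / 3) (by positivity) fun φ hφ => ?_).trans_lt
    (by linarith)
  have hx := (hφ.abs_integral_sub_le_dLstar (P s t x) (P s t x₀)).trans
    (hT s hsT x x₀ (by simp) (by simp))
  have hx₀ : |(∫ y, φ y ∂(P s t x₀)) - ∫ y, φ y ∂μ| ≤ ε / 3 := by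
    refine le_of_tendsto (tendsto_const_nhds.sub (hlim φ hφ)).abs ?_
    obtain ⟨N, hN⟩ := exists_nat_ge (t - s)
    filter_upwards [eventually_ge_atTop N] with n hn
    have hNk : (N : ℝ) ≤ k n := by exact_mod_cast hn.trans (hk.id_le n)
    rw [abs_sub_comm]
    exact (hφ.abs_integral_sub_le_dLstar _ _).trans (hs₀ s hs _ (by linarith))
  exact (abs_sub_le _ _ _).trans (add_le_add hx hx₀)
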